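/- arXiv:1702.01338 — 3 statements merged into one kernel-verified Lean document; each statement's English description precedes it below -/
import Mathlib

section
/- Let (W,S) be the Coxeter system with S = {0,1,2}, m(0,1) = m(0,2) = 3, and m(1,2) = ∞. For x ∈ Γ_0 ∩ Γ_0^{-1} with unique reduced word s_1 s_2 ⋯ s_k, let w_x be the word over the alphabet {a,b} obtained by reading the consecutive pairs (s_i, s_{i+1}) for i = 1, …, k−1 in order and recording the letter a whenever (s_i, s_{i+1}) = (1,2), recording the letter b whenever (s_i, s_{i+1}) = (2,1), and recording nothing otherwise. Then the map x ↦ w_x is a bijection from Γ_0 ∩ Γ_0^{-1} onto the free monoid of all words over {a,b} (with the element 0 mapping to the empty word). -/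
/-!
Common definitions: alternating words, glued products, dihedral segment
decompositions, unique reduced words, and the subregular set `C`.
-/

/-- The alternating word `(s,t)_l = s t s ⋯` of length `l` beginning with `s`. -/
def altWord {B : Type*} (s t : B) : ℕ → List B
  | 0 => []
  | k + 1 => s :: altWord t s k

/-- The glued product `x * y` of two words: the concatenation of `x` and `y` with one of the
two adjacent occurrences of the common letter deleted (intended for use when the last letter
of `x` equals the first letter of `y`). -/
def glueWord {B : Type*} (x y : List B) : List B := x ++ y.tail

/-- Iterated glued product `g₁ * g₂ * ⋯ * gₘ`. -/
def glueFold {B : Type*} : List (List B) → List B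
  | [] => []
  | g :: rest => rest.foldl glueWord g

/-- `segs` is the list of dihedral segments of the word `x`: the maximal contiguous subwords of
`x` involving (at most) two distinct letters.  Each segment alternates in two distinct letters,
consecutive segments overlap in one letter (so that the glued product of the segments is `x`),
and maximality is expressed by requiring that consecutive segments have different letter sets. -/
def IsDihedralDecomp {B : Type*} (x : List B) (segs : List (List B)) : Prop :=
  segs ≠ [] ∧
  (∀ seg ∈ segs, ∃ s t : B, s ≠ t ∧ seg ≠ [] ∧ seg = altWord s t seg.length) ∧
  (2 ≤ segs.length → ∀ seg ∈ segs, 2 ≤ seg.length) ∧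
  segs.Chain' (fun u v => u.getLast? = v.head? ∧ ({a | a ∈ u} : Set B) ≠ {a | a ∈ v}) ∧
  x = glueFold segs

variable {B : Type*} {W : Type*} [Group W]

/-- `ω` is the unique reduced word of `w`. -/
def IsUniqueReducedWord {M : CoxeterMatrix B} (cs : CoxeterSystem M W)
    (w : W) (ω : List B) : Prop :=
  cs.wordProd ω = w ∧ cs.IsReduced ω ∧
    ∀ ω' : List B, cs.wordProd ω' = w → cs.IsReduced ω' → ω' = ω

/-- The subregular set `C`: the non-identity elements of `W` admitting exactly one
reduced word. -/
def subregularSet {M : CoxeterMatrix B} (cs : CoxeterSystem M W) : Set W :=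
  {w | w ≠ 1 ∧ ∃ ω : List B, IsUniqueReducedWord cs w ω}

/-- `Γ_s ∩ Γ_s⁻¹`: the elements of the subregular set whose unique reduced word both starts
and ends with `s`. -/
def gammaSet {M : CoxeterMatrix B} (cs : CoxeterSystem M W) (s : B) : Set W :=
  {w | w ≠ 1 ∧ ∃ ω : List B, IsUniqueReducedWord cs w ω ∧
    ω.head? = some s ∧ ω.getLast? = some s}

/-- Reading the consecutive pairs of a word over `{0,1,2}` and recording `true` (the letter
`a`) for each pair `(1,2)` and `false` (the letter `b`) for each pair `(2,1)`, ignoring all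
other pairs. -/
def encodeWord : List (Fin 3) → List Bool
  | [] => []
  | [_] => []
  | s :: t :: rest =>
      (if s = 1 ∧ t = 2 then [true]
       else if s = 2 ∧ t = 1 then [false]
       else []) ++ encodeWord (t :: rest)

namespace SubregularRigid

/-- The letter `a` can be put in front of the word `l` without creating a factor `aa`, or a factor
`aba` with `m(a,b) = 3`. -/
def Prependable (a : Fin 3) : List (Fin 3) → Prop
  | [] => True
  | [b] => a ≠ b
  | b :: c :: _ => a ≠ b ∧ ¬(c = a ∧ (a = 0 ∨ b = 0))

/-- A word without factors `aa`, and without factors `aba` with `m(a,b) = 3`. -/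
def Rigid : List (Fin 3) → Prop
  | [] => True
  | a :: l => Prependable a l ∧ Rigid l

theorem exists_wordProd_eq_of_not_rigid {M : CoxeterMatrix (Fin 3)} (cs : CoxeterSystem M W)
    (h01 : M 0 1 = 3) (h02 : M 0 2 = 3) : ∀ ω : List (Fin 3), ¬ Rigid ω →
    ∃ ω', cs.wordProd ω' = cs.wordProd ω ∧ ω' ≠ ω ∧ ω'.length ≤ ω.length
  | [], h => by simp [Rigid] at h
  | a :: l, h => by
    by_cases hl : Rigid l
    · have hp : ¬ Prependable a l := fun hp => h ⟨hp, hl⟩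
      have cancel : ∀ l', ∃ ω', cs.wordProd ω' = cs.wordProd (a :: a :: l') ∧
          ω' ≠ a :: a :: l' ∧ ω'.length ≤ (a :: a :: l').length := fun l' =>
        ⟨l', by simp [cs.wordProd_cons], fun e => by have := congrArg List.length e; simp at this; omega,
          by simp; omega⟩
      match l, hp with
      | [], hp => simp [Prependable] at hp
      | [b], hp =>
        obtain rfl : a = b := by simpa [Prependable] using hp
        exact cancel _
      | b :: c :: l', hp =>
        by_cases hab : a = b
        · subst hab
          exact cancel _
        · obtain ⟨rfl, h0⟩ : c = a ∧ (a = 0 ∨ b = 0) := by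
            by_contra hc
            exact hp ⟨hab, hc⟩
          have hm : M c b = 3 := by
            have h10 := M.symmetric 0 1
            have h20 := M.symmetric 0 2
            rcases h0 with rfl | rfl
            · fin_cases b <;> simp_all
            · fin_cases c <;> simp_all
          refine ⟨b :: c :: b :: l', ?_, ?_, by simp⟩
          · have hpow := cs.simple_mul_simple_pow c b
            rw [hm] at hpow
            simp only [cs.wordProd_cons, ← mul_assoc]
            congr 1
            have hinv : (cs.simple c * cs.simple b * cs.simple c) *
                (cs.simple b * cs.simple c * cs.simple b) = 1 := by
              rw [← hpow]; simp only [pow_succ, pow_zero, one_mul, mul_assoc]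
            rw [mul_eq_one_iff_eq_inv] at hinv
            rw [hinv]
            simp [mul_assoc]
          · intro e
            exact hab (List.cons.inj e).1.symm
    · obtain ⟨ω', h1, h2, h3⟩ := exists_wordProd_eq_of_not_rigid cs h01 h02 l hl
      exact ⟨a :: ω', by simp [cs.wordProd_cons, h1], by simpa using h2, by simpa using h3⟩

theorem rigid_of_isUniqueReducedWord {M : CoxeterMatrix (Fin 3)} (cs : CoxeterSystem M W)
    (h01 : M 0 1 = 3) (h02 : M 0 2 = 3) {w : W} {ω : List (Fin 3)}
    (h : IsUniqueReducedWord cs w ω) : Rigid ω := by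
  by_contra hr
  obtain ⟨ω', h1, h2, h3⟩ := exists_wordProd_eq_of_not_rigid cs h01 h02 ω hr
  obtain ⟨rfl, hred, huniq⟩ := h
  refine h2 (huniq ω' h1 (le_antisymm (cs.length_wordProd_le ω') ?_))
  rw [h1, hred.eq]
  exact h3

open Classical in
/-- The value at a word `l` of the operator `s - 1` applied to `f`, for the action of the simple
reflection `s` on functions on words dual to the subregular cell representation. -/
noncomputable def cellValue (s : Fin 3) (f : List (Fin 3) → ℤ) : List (Fin 3) → ℤ
  | [] => f [s]
  | a :: l =>
    if Rigid (a :: l) then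
      if a = s then -2 * f (a :: l)
      else (if Prependable s (a :: l) then f (s :: a :: l) else 0) +
        (if l.head? = some s then f l else 0)
    else 0

/-- The operator `s - 1` on functions on words. -/
noncomputable def cellOp (s : Fin 3) : Module.End ℤ (List (Fin 3) → ℤ) where
  toFun := cellValue s
  map_add' f g := by
    funext l
    cases l with
    | nil => simp [cellValue]
    | cons a l => simp only [cellValue, Pi.add_apply]; split_ifs <;> ring
  map_smul' c f := by
    funext l
    cases l with
    | nil => simp [cellValue]
    | cons a l =>
      simp only [cellValue, Pi.smul_apply, smul_eq_mul, RingHom.id_apply]; split_ifs <;> ring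

theorem cellValue_congr {s : Fin 3} {f g : List (Fin 3) → ℤ}
    (h : ∀ l, Rigid (s :: l) → f (s :: l) = g (s :: l)) (l : List (Fin 3)) :
    cellValue s f l = cellValue s g l := by
  match l with
  | [] => exact h [] (by simp [Rigid, Prependable])
  | [a] =>
    have h1 := h [a]
    have h2 := h []
    simp only [cellValue, Rigid] at *
    grind
  | a :: b :: l =>
    have h1 := h (a :: b :: l)
    have h2 := h l
    have h3 := h (b :: l)
    simp only [cellValue, Rigid] at *
    grind

theorem cellValue_cellValue_cons {s t : Fin 3} (hst : s ≠ t) (h0 : s = 0 ∨ t = 0)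
    (f : List (Fin 3) → ℤ) (l : List (Fin 3)) (hl : Rigid (s :: l)) :
    cellValue t (cellValue s f) (s :: l) = f (s :: l) := by
  match l with
  | [] =>
    simp only [cellValue, Rigid, Prependable]
    grind
  | [a] =>
    simp only [cellValue, Rigid, Prependable] at *
    grind
  | a :: b :: l =>
    have hsab : s ≠ a ∧ ¬(b = s ∧ (s = 0 ∨ a = 0)) := hl.1
    have hr : Rigid (a :: b :: l) := hl.2
    by_cases hat : a = t
    · subst hat
      have hp : ¬ Prependable a (s :: a :: b :: l) := by simp [Prependable]; grind
      simp [cellValue, hl, hst, hp, hr, Ne.symm hst, hl.1]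
      grind
    · have hp : Prependable t (s :: a :: b :: l) := ⟨Ne.symm hst, by grind⟩
      have hq : ¬ Prependable s (t :: s :: a :: b :: l) := by simp [Prependable]; grind
      have hr' : Rigid (t :: s :: a :: b :: l) := ⟨hp, hl⟩
      simp [cellValue, hl, hst, hp, hq, hr', Ne.symm hst, hat]

theorem cellOp_mul_self (s : Fin 3) : cellOp s * cellOp s = -2 • cellOp s := by
  refine LinearMap.ext fun f => ?_
  have h : cellOp s (cellOp s f) = cellOp s ((-2 : ℤ) • f) := by
    funext l
    refine cellValue_congr (fun l hl => ?_) l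
    simp [cellOp, cellValue, hl]
  rw [map_smul] at h
  exact h

theorem cellOp_mul_mul_self {s t : Fin 3} (hst : s ≠ t) (h0 : s = 0 ∨ t = 0) :
    cellOp s * cellOp t * cellOp s = cellOp s :=
  LinearMap.ext fun f => funext fun l =>
    cellValue_congr (cellValue_cellValue_cons hst h0 f) l

theorem one_add_mul_pow_three {R : Type*} [Ring R] {e d : R} (he : e * e = -2 • e)
    (hd : d * d = -2 • d) (hed : e * d * e = e) (hde : d * e * d = d) :
    ((1 + e) * (1 + d)) ^ 3 = 1 := by
  have hsq : ∀ x : R, x * x = -2 • x → (1 + x) * (1 + x) = 1 := fun x hx => by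
    have : (1 + x) * (1 + x) = 1 + 2 • x + x * x := by noncomm_ring
    rw [this, hx]; abel
  have hbr : (1 + e) * (1 + d) * (1 + e) = (1 + d) * (1 + e) * (1 + d) := by
    have h1 : (1 + e) * (1 + d) * (1 + e) = 1 + 2 • e + d + e * d + d * e + e * e + e * d * e := by
      noncomm_ring
    have h2 : (1 + d) * (1 + e) * (1 + d) = 1 + 2 • d + e + e * d + d * e + d * d + d * e * d := by
      noncomm_ring
    rw [h1, h2, he, hd, hed, hde]; abel
  calc ((1 + e) * (1 + d)) ^ 3
      = ((1 + e) * (1 + d) * (1 + e)) * ((1 + d) * (1 + e) * (1 + d)) := by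
        simp only [pow_succ, pow_zero, one_mul, mul_assoc]
    _ = (1 + d) * ((1 + e) * ((1 + d) * (1 + d)) * (1 + e)) * (1 + d) := by
        rw [hbr]; simp only [mul_assoc]
    _ = 1 := by rw [hsq d hd, mul_one, hsq e he, mul_one, hsq d hd]

theorem isLiftable_one_add_cellOp {M : CoxeterMatrix (Fin 3)}
    (h01 : M 0 1 = 3) (h02 : M 0 2 = 3) (h12 : M 1 2 = 0) :
    M.IsLiftable (fun s => 1 + cellOp s) := by
  have hb : ∀ s t : Fin 3, s ≠ t → (s = 0 ∨ t = 0) →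
      ((1 + cellOp s) * (1 + cellOp t)) ^ 3 = 1 := fun s t hst h0 =>
    one_add_mul_pow_three (cellOp_mul_self s) (cellOp_mul_self t) (cellOp_mul_mul_self hst h0)
      (cellOp_mul_mul_self hst.symm h0.symm)
  have h10 : M 1 0 = 3 := (M.symmetric 1 0).trans h01
  have h20 : M 2 0 = 3 := (M.symmetric 2 0).trans h02
  have h21 : M 2 1 = 0 := (M.symmetric 2 1).trans h12
  intro s t
  by_cases hst : s = t
  · subst hst
    have h : (1 + cellOp s) * (1 + cellOp s) = 1 + 2 • cellOp s + cellOp s * cellOp s := by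
      noncomm_ring
    simp only [M.diagonal, pow_one]
    rw [h, cellOp_mul_self]
    abel
  · fin_cases s <;> fin_cases t <;> simp_all

/-- The representation of `W` on functions on words. -/
noncomputable def cellRep {M : CoxeterMatrix (Fin 3)} (cs : CoxeterSystem M W)
    (h01 : M 0 1 = 3) (h02 : M 0 2 = 3) (h12 : M 1 2 = 0) :
    W →* Module.End ℤ (List (Fin 3) → ℤ) :=
  cs.lift ⟨_, isLiftable_one_add_cellOp h01 h02 h12⟩

theorem cellRep_wordProd_cons {M : CoxeterMatrix (Fin 3)} (cs : CoxeterSystem M W)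
    (h01 : M 0 1 = 3) (h02 : M 0 2 = 3) (h12 : M 1 2 = 0) (s : Fin 3) (ω : List (Fin 3))
    (f : List (Fin 3) → ℤ) (l : List (Fin 3)) :
    cellRep cs h01 h02 h12 (cs.wordProd (s :: ω)) f l =
      cellRep cs h01 h02 h12 (cs.wordProd ω) f l +
        cellValue s (cellRep cs h01 h02 h12 (cs.wordProd ω) f) l := by
  rw [cs.wordProd_cons, map_mul, Module.End.mul_apply]
  have : cellRep cs h01 h02 h12 (cs.simple s) = 1 + cellOp s := cs.lift_apply_simple _ s
  rw [this]
  rfl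

open Classical in
theorem cellRep_wordProd_apply {M : CoxeterMatrix (Fin 3)} (cs : CoxeterSystem M W)
    (h01 : M 0 1 = 3) (h02 : M 0 2 = 3) (h12 : M 1 2 = 0) {f : List (Fin 3) → ℤ} {n : ℕ}
    (hf : ∀ l, l.length < n → f l = 0) (ω : List (Fin 3)) :
    ∀ l, Rigid l → ω.length + l.length ≤ n →
      cellRep cs h01 h02 h12 (cs.wordProd ω) f l =
        if ω.length + l.length = n ∧ Rigid (ω.reverse ++ l) then f (ω.reverse ++ l) else 0 := by
  induction ω with
  | nil =>
    intro l hl hn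
    simp only [CoxeterSystem.wordProd_nil, map_one, Module.End.one_apply, List.length_nil, zero_add,
      List.reverse_nil, List.nil_append, hl, and_true]
    split_ifs with h
    · rfl
    · exact hf l (by simp at hn; omega)
  | cons s ω ih =>
    intro l hl hn
    simp only [List.length_cons] at hn
    rw [cellRep_wordProd_cons, ih l hl (by omega), if_neg (by omega), zero_add]
    have hr : Rigid ((s :: ω).reverse ++ l) → Rigid (s :: l) := by
      simp only [List.reverse_cons, List.append_assoc, List.singleton_append]
      generalize ω.reverse = q
      induction q with
      | nil => exact id
      | cons a q ihq => exact fun h => ihq h.2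
    match l with
    | [] =>
      rw [cellValue, ih [s] (by simp [Rigid, Prependable]) (by simpa using hn)]
      simp
    | a :: l =>
      simp only [List.length_cons] at hn
      have h1 := ih (a :: l) hl (by simp; omega)
      have h2 := ih l hl.2 (by omega)
      rw [if_neg (by simp; omega)] at h1
      rw [if_neg (by omega)] at h2
      rw [cellValue, if_pos hl, h1, h2]
      by_cases hp : Prependable s (a :: l)
      · have has : a ≠ s := by cases l <;> simp_all [Prependable] <;> grind
        rw [if_neg has, if_pos hp, ih (s :: a :: l) ⟨hp, hl⟩ (by simp; omega)]
        simp [Nat.add_assoc, Nat.add_comm 1]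
      · have : ¬ Rigid ((s :: ω).reverse ++ (a :: l)) := fun h => hp (hr h).1
        simp [hp]
        simpa using fun _ h => absurd h (by simpa using this)

theorem isUniqueReducedWord_of_rigid {M : CoxeterMatrix (Fin 3)} (cs : CoxeterSystem M W)
    (h01 : M 0 1 = 3) (h02 : M 0 2 = 3) (h12 : M 1 2 = 0) {ω : List (Fin 3)} (hω : Rigid ω) :
    IsUniqueReducedWord cs (cs.wordProd ω) ω := by
  classical
  have key : ∀ ω', cs.wordProd ω' = cs.wordProd ω → ω'.length ≤ ω.length → ω' = ω := by
    intro ω' he hle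
    have happ := cellRep_wordProd_apply cs h01 h02 h12 (f := Pi.single ω 1) (n := ω.length)
      (fun l hl => Pi.single_eq_of_ne (by rintro rfl; omega) _)
    have h1 := happ ω.reverse [] trivial (by simp)
    have h2 := happ ω'.reverse [] trivial (by simpa using hle)
    simp only [cs.wordProd_reverse, he] at h1 h2
    rw [h1] at h2
    by_contra hne
    simp [hω, hne] at h2
  obtain ⟨ω', hred, he⟩ := cs.exists_isReduced (cs.wordProd ω)
  have hle : ω'.length ≤ ω.length := by
    rw [← hred.eq, ← he]; exact cs.length_wordProd_le ω
  have := key ω' he.symm hle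
  subst this
  exact ⟨rfl, hred, fun υ hυ hred' => key υ hυ (by rw [← hred.eq, ← hred'.eq, hυ])⟩

/-- The source of the edge traversal recorded by a letter. -/
def edgeSource (x : Bool) : Fin 3 := if x then 1 else 2

/-- The target of the edge traversal recorded by a letter. -/
def edgeTarget (x : Bool) : Fin 3 := if x then 2 else 1

/-- The part of the decoded word following the source of the first traversal `x`. -/
def decodeFrom (x : Bool) : List Bool → List (Fin 3)
  | [] => [edgeTarget x, 0]
  | y :: ys =>
    if y = x then edgeTarget x :: 0 :: edgeSource y :: decodeFrom y ys
    else edgeTarget x :: decodeFrom y ys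

/-- The rigid word starting and ending with `0` having prescribed traversals. -/
def decodeWord : List Bool → List (Fin 3)
  | [] => [0]
  | x :: xs => 0 :: edgeSource x :: decodeFrom x xs

theorem decodeFrom_eq_cons (x : Bool) (xs : List Bool) :
    ∃ l, decodeFrom x xs = edgeTarget x :: l := by
  cases xs with
  | nil => exact ⟨_, rfl⟩
  | cons y ys => rw [decodeFrom]; split_ifs <;> exact ⟨_, rfl⟩

theorem decodeFrom_spec (xs : List Bool) : ∀ x : Bool,
    Rigid (edgeSource x :: decodeFrom x xs) ∧
      encodeWord (edgeSource x :: decodeFrom x xs) = x :: xs ∧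
      (edgeSource x :: decodeFrom x xs).getLast? = some 0 := by
  induction xs with
  | nil => intro x; cases x <;>
      simp [decodeFrom, edgeSource, edgeTarget, Rigid, Prependable, encodeWord]
  | cons y ys ih =>
    intro x
    obtain ⟨l, hl⟩ := decodeFrom_eq_cons y ys
    obtain ⟨h1, h2, h3⟩ := ih y
    rw [decodeFrom, hl]
    rw [hl] at h1 h2 h3
    cases x <;> cases y <;>
      simp_all [edgeSource, edgeTarget, Rigid, Prependable, encodeWord, List.getLast?_cons_cons]

theorem decodeWord_spec (xs : List Bool) :
    Rigid (decodeWord xs) ∧ encodeWord (decodeWord xs) = xs ∧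
      (decodeWord xs).head? = some 0 ∧ (decodeWord xs).getLast? = some 0 := by
  cases xs with
  | nil => simp [decodeWord, Rigid, Prependable, encodeWord]
  | cons x xs =>
    obtain ⟨l, hl⟩ := decodeFrom_eq_cons x xs
    obtain ⟨h1, h2, h3⟩ := decodeFrom_spec xs x
    rw [decodeWord, hl]
    rw [hl] at h1 h2 h3
    cases x <;>
      simp_all [edgeSource, edgeTarget, Rigid, Prependable, encodeWord, List.getLast?_cons_cons]

theorem exists_eq_decodeFrom : ∀ (l : List (Fin 3)) (x : Bool),
    Rigid (edgeSource x :: edgeTarget x :: l) →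
    (edgeSource x :: edgeTarget x :: l).getLast? = some 0 →
    ∃ xs, edgeTarget x :: l = decodeFrom x xs
  | [], x, _, h => by cases x <;> simp [edgeTarget] at h
  | [c], x, hr, h => ⟨[], by simp_all [decodeFrom]⟩
  | c :: d :: l, x, hr, h => by
    by_cases hc : c = 0
    · subst hc
      match l with
      | [] => simp_all [Rigid, Prependable]
      | e :: l =>
        have hd : d = edgeSource x ∧ e = edgeTarget x := by
          have h1 : _ ∧ ¬(d = edgeTarget x ∧ _) := hr.2.1
          have h2 : 0 ≠ d ∧ ¬(e = 0 ∧ _) := hr.2.2.1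
          have h3 : d ≠ e := by
            have := hr.2.2.2.1
            cases l <;> simp_all [Prependable]
          cases x <;> fin_cases d <;> fin_cases e <;> simp_all [edgeSource, edgeTarget]
        obtain ⟨rfl, rfl⟩ := hd
        obtain ⟨xs, hxs⟩ := exists_eq_decodeFrom l x hr.2.2.2 (by simpa using h)
        exact ⟨x :: xs, by simp [decodeFrom, hxs]⟩
    · have hc' : edgeTarget x = edgeSource (!x) ∧ c = edgeTarget (!x) := by
        have := hr.2.1
        cases x <;> fin_cases c <;>
          simp_all [edgeSource, edgeTarget, Prependable]
      obtain ⟨h1, rfl⟩ := hc'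
      obtain ⟨xs, hxs⟩ := exists_eq_decodeFrom (d :: l) (!x) (h1 ▸ hr.2) (by
        rw [← h1]; simpa using h)
      exact ⟨(!x) :: xs, by simp [decodeFrom, hxs]⟩

theorem exists_eq_decodeWord {ω : List (Fin 3)} (hr : Rigid ω) (hh : ω.head? = some 0)
    (hl : ω.getLast? = some 0) : ∃ xs, ω = decodeWord xs := by
  match ω with
  | [] => simp at hh
  | [a] => exact ⟨[], by simp_all [decodeWord]⟩
  | [a, b] => simp_all [Rigid, Prependable]
  | a :: b :: c :: l =>
    obtain rfl : a = 0 := by simpa using hh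
    obtain ⟨x, rfl, rfl⟩ : ∃ x, b = edgeSource x ∧ c = edgeTarget x := by
      rw [Bool.exists_bool]
      have h1 : 0 ≠ b ∧ ¬(c = 0 ∧ _) := hr.1
      have h2 : b ≠ c := by
        have := hr.2.1
        cases l <;> simp_all [Prependable]
      simp [edgeSource, edgeTarget]
      fin_cases b <;> fin_cases c <;> simp_all
    obtain ⟨xs, hxs⟩ := exists_eq_decodeFrom l x hr.2 (by simpa using hl)
    exact ⟨x :: xs, by rw [decodeWord, hxs]⟩

end SubregularRigid

/-- For the Coxeter system with `S = {0,1,2}`, `m(0,1) = m(0,2) = 3` and `m(1,2) = ∞`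
(encoded by `0`), the map `x ↦ w_x` reading off the traversals of the edge `{1,2}` from the
unique reduced word is a bijection from `Γ_0 ∩ Γ_0⁻¹` onto the free monoid of all words over
`{a,b}` (here `List Bool`), with the element `0` mapping to the empty word. -/
theorem gammaSet_encode_bijection {M : CoxeterMatrix (Fin 3)} (cs : CoxeterSystem M W)
    (h01 : M 0 1 = 3) (h02 : M 0 2 = 3) (h12 : M 1 2 = 0)
    (f : W → List (Fin 3))
    (hf : ∀ w ∈ gammaSet cs 0, IsUniqueReducedWord cs w (f w)) :
    Set.BijOn (fun w => encodeWord (f w)) (gammaSet cs 0) Set.univ ∧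
    encodeWord (f (cs.simple 0)) = [] := by
  have hw : ∀ w ∈ gammaSet cs 0, cs.wordProd (f w) = w ∧
      f w = SubregularRigid.decodeWord (encodeWord (f w)) := by
    intro w hw
    have hfw := hf w hw
    obtain ⟨-, ω, hω, hh, hl⟩ := hw
    have he : ω = f w := hfw.2.2 ω hω.1 hω.2.1
    obtain ⟨xs, hxs⟩ := SubregularRigid.exists_eq_decodeWord
      (SubregularRigid.rigid_of_isUniqueReducedWord cs h01 h02 hω) hh hl
    refine ⟨hfw.1, ?_⟩
    rw [← he, hxs, (SubregularRigid.decodeWord_spec xs).2.1]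
  have hdec : ∀ xs, cs.wordProd (SubregularRigid.decodeWord xs) ∈ gammaSet cs 0 ∧
      f (cs.wordProd (SubregularRigid.decodeWord xs)) = SubregularRigid.decodeWord xs := by
    intro xs
    obtain ⟨hr, -, hh, hl⟩ := SubregularRigid.decodeWord_spec xs
    have hu := SubregularRigid.isUniqueReducedWord_of_rigid cs h01 h02 h12 hr
    have hmem : cs.wordProd (SubregularRigid.decodeWord xs) ∈ gammaSet cs 0 := by
      refine ⟨fun h1 => ?_, _, hu, hh, hl⟩
      have hlen := hu.2.1.eq
      rw [h1, cs.length_one] at hlen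
      rw [List.eq_nil_of_length_eq_zero hlen.symm] at hh
      simp at hh
    exact ⟨hmem, hu.2.2 _ (hf _ hmem).1 (hf _ hmem).2.1⟩
  refine ⟨⟨fun _ _ => Set.mem_univ _, fun w hw₁ w' hw₂ he => ?_, fun xs _ => ?_⟩, ?_⟩
  · rw [← (hw w hw₁).1, ← (hw w' hw₂).1, (hw w hw₁).2, (hw w' hw₂).2]
    exact congrArg (fun xs => cs.wordProd (SubregularRigid.decodeWord xs)) he
  · refine ⟨_, (hdec xs).1, ?_⟩
    simp only [(hdec xs).2, (SubregularRigid.decodeWord_spec xs).2.1]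
  · have h0 := (hdec []).2
    simp only [SubregularRigid.decodeWord, cs.wordProd_singleton] at h0
    simp [h0, encodeWord]
end

section
/- Let (W,S) be the Coxeter system with S = {1,2,3}, m(1,2) = 4, m(2,3) = 4, and m(1,3) = 2. Then Γ_1 ∩ Γ_1^{-1} consists exactly of the following elements: the generator 1 (with reduced word '1'); the element with reduced word 121; and, for each integer n ≥ 1, the element y_n whose unique reduced word is the block 1232 repeated n times followed by the letter 1 (e.g., y_1 = 12321, y_2 = 123212321). -/
variable {B : Type*} {W : Type*} [Group W]

/-- The word `(1232)ⁿ 1` over `S = {1,2,3}` (encoded as `Fin 3` via `1 ↦ 0`, `2 ↦ 1`,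
`3 ↦ 2`): the block `1232` repeated `n` times followed by the letter `1`. -/
def yWord (n : ℕ) : List (Fin 3) :=
  (List.replicate n ([0, 1, 2, 1] : List (Fin 3))).flatten ++ [0]

/-- The action of the generators on the four Shi coordinates of an alcove of type `C̃₂`. -/
def shiAct : Fin 3 → ℤ × ℤ × ℤ × ℤ → ℤ × ℤ × ℤ × ℤ
  | 0, (a, b, c, d) => (-1 - a, b, d, c)
  | 1, (a, b, c, d) => (b, a, c, -1 - d)
  | 2, (a, b, c, d) => (a, 1 - b, -d, -c)

theorem shiAct_shiAct (i : Fin 3) (x : ℤ × ℤ × ℤ × ℤ) : shiAct i (shiAct i x) = x := by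
  obtain ⟨a, b, c, d⟩ := x
  fin_cases i <;> simp [shiAct]

/-- `shiAct i` as a permutation. -/
def shiPerm (i : Fin 3) : Equiv.Perm (ℤ × ℤ × ℤ × ℤ) where
  toFun := shiAct i
  invFun := shiAct i
  left_inv := shiAct_shiAct i
  right_inv := shiAct_shiAct i

/-- The number of hyperplanes separating the alcove with given Shi coordinates from the base. -/
def shiNorm : ℤ × ℤ × ℤ × ℤ → ℤ
  | (a, b, c, d) => |a| + |b| + |c| + |d|

theorem shiNorm_shiAct_le (i : Fin 3) (x : ℤ × ℤ × ℤ × ℤ) :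
    shiNorm (shiAct i x) ≤ shiNorm x + 1 := by
  obtain ⟨a, b, c, d⟩ := x
  fin_cases i <;> simp [shiAct, shiNorm] <;> grind

/-- The Shi coordinates of the alcove reached from the base alcove by a word. -/
def shiPos (ω : List (Fin 3)) : ℤ × ℤ × ℤ × ℤ := ω.foldr shiAct (0, 0, 0, 0)

@[simp] theorem shiPos_nil : shiPos [] = (0, 0, 0, 0) := rfl

@[simp] theorem shiPos_cons (i : Fin 3) (ω : List (Fin 3)) :
    shiPos (i :: ω) = shiAct i (shiPos ω) := rfl

theorem shiNorm_shiPos_le (ω : List (Fin 3)) : shiNorm (shiPos ω) ≤ ω.length := by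
  induction ω with
  | nil => simp [shiNorm]
  | cons i ω ih =>
    have := shiNorm_shiAct_le i (shiPos ω)
    simp only [shiPos_cons, List.length_cons, Nat.cast_add, Nat.cast_one]
    linarith

theorem isLiftable_shiPerm {M : CoxeterMatrix (Fin 3)}
    (h01 : M 0 1 = 4) (h12 : M 1 2 = 4) (h02 : M 0 2 = 2) : M.IsLiftable shiPerm := by
  have h10 : M 1 0 = 4 := by rw [M.symmetric, h01]
  have h21 : M 2 1 = 4 := by rw [M.symmetric, h12]
  have h20 : M 2 0 = 2 := by rw [M.symmetric, h02]
  intro i j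
  ext1 ⟨a, b, c, d⟩
  fin_cases i <;> fin_cases j <;>
    simp [h01, h12, h02, h10, h21, h20, pow_succ, shiPerm, shiAct]

theorem shiPos_eq_of_wordProd_eq {M : CoxeterMatrix (Fin 3)} (cs : CoxeterSystem M W)
    (h01 : M 0 1 = 4) (h12 : M 1 2 = 4) (h02 : M 0 2 = 2) {ω ω' : List (Fin 3)}
    (h : cs.wordProd ω = cs.wordProd ω') : shiPos ω = shiPos ω' := by
  have key (ω : List (Fin 3)) :
      cs.lift ⟨shiPerm, isLiftable_shiPerm h01 h12 h02⟩ (cs.wordProd ω) (0, 0, 0, 0) =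
        shiPos ω := by
    induction ω with
    | nil => simp
    | cons i ω ih =>
      rw [cs.wordProd_cons, map_mul, Equiv.Perm.mul_apply, ih, cs.lift_apply_simple]
      rfl
  rw [← key, ← key, h]

/-- A word is rigid if it is the only word of at most its length reaching its alcove. -/
def IsRigid (ω : List (Fin 3)) : Prop :=
  ∀ ω' : List (Fin 3), ω'.length ≤ ω.length → shiPos ω' = shiPos ω → ω' = ω

theorem isRigid_nil : IsRigid [] := fun _ h _ => List.length_eq_zero_iff.1 (Nat.le_zero.1 h)

theorem IsRigid.cons {ω : List (Fin 3)} (h : IsRigid ω) {i : Fin 3}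
    (hpos : 0 < shiNorm (shiPos (i :: ω)))
    (hup : ∀ j, j ≠ i → (ω.length : ℤ) < shiNorm (shiAct j (shiPos (i :: ω)))) :
    IsRigid (i :: ω) := by
  rintro (_ | ⟨j, τ⟩) hlen heq
  · rw [← heq] at hpos
    simp [shiNorm] at hpos
  · have hlen' : τ.length ≤ ω.length := by simpa using hlen
    by_cases hj : j = i
    · subst hj
      rw [h τ hlen' ((shiPerm j).injective heq)]
    · have h1 := hup j hj
      rw [← heq, shiPos_cons, shiAct_shiAct] at h1
      have h2 := shiNorm_shiPos_le τ
      omega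

theorem IsRigid.isUniqueReducedWord {M : CoxeterMatrix (Fin 3)} (cs : CoxeterSystem M W)
    (h01 : M 0 1 = 4) (h12 : M 1 2 = 4) (h02 : M 0 2 = 2) {ω : List (Fin 3)}
    (h : IsRigid ω) : IsUniqueReducedWord cs (cs.wordProd ω) ω := by
  refine ⟨rfl, ?_, fun ω' hω' hr => ?_⟩
  · obtain ⟨τ, hτ, hprod⟩ := cs.exists_isReduced (cs.wordProd ω)
    have hlen : τ.length ≤ ω.length := by
      rw [← hτ.eq, ← hprod]
      exact cs.length_wordProd_le ω
    rwa [← h τ hlen (shiPos_eq_of_wordProd_eq cs h01 h12 h02 hprod.symm)]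
  · refine h ω' ?_ (shiPos_eq_of_wordProd_eq cs h01 h12 h02 hω')
    rw [← hr.eq, hω']
    exact cs.length_wordProd_le ω

theorem yWord_zero : yWord 0 = [0] := rfl

theorem yWord_succ (n : ℕ) : yWord (n + 1) = 0 :: 1 :: 2 :: 1 :: yWord n := by
  simp [yWord, List.replicate_succ]

theorem length_yWord (n : ℕ) : (yWord n).length = 4 * n + 1 := by
  induction n with
  | zero => rfl
  | succ n ih => simp only [yWord_succ, List.length_cons, ih]; ring

theorem shiPos_yWord (n : ℕ) : shiPos (yWord n) = ((-1 - 2 * n, 0, -n, n) : ℤ × ℤ × ℤ × ℤ) := by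
  induction n with
  | zero => rfl
  | succ n ih =>
    simp only [yWord_succ, shiPos_cons, ih, shiAct, Nat.cast_succ, Prod.mk.injEq]
    refine ⟨?_, ?_, ?_, ?_⟩ <;> lia

theorem isRigid_zero : IsRigid [0] := by
  refine isRigid_nil.cons (by simp [shiAct, shiNorm]) fun j hj => ?_
  fin_cases j <;> simp_all [shiAct, shiNorm]

theorem isRigid_zero_one_zero : IsRigid [0, 1, 0] := by
  refine (isRigid_zero.cons ?_ fun j hj => ?_).cons ?_ fun j hj => ?_
  any_goals fin_cases j
  all_goals simp_all [shiAct, shiNorm]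

theorem isRigid_yWord (n : ℕ) : IsRigid (yWord n) := by
  induction n with
  | zero => exact isRigid_zero
  | succ n ih =>
    rw [yWord_succ]
    refine (((ih.cons ?_ fun j hj => ?_).cons ?_ fun j hj => ?_).cons ?_ fun j hj => ?_).cons
      ?_ fun j hj => ?_
    any_goals fin_cases j
    all_goals try simp at hj
    all_goals simp [shiAct, shiNorm, shiPos_yWord, length_yWord]
    all_goals grind

theorem head?_yWord (n : ℕ) : (yWord n).head? = some 0 := by
  cases n with
  | zero => rfl
  | succ n => rw [yWord_succ]; rfl

theorem getLast?_yWord (n : ℕ) : (yWord n).getLast? = some 0 := by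
  simp [yWord]

theorem IsUniqueReducedWord.eq_of_wordProd_eq {M : CoxeterMatrix B} {cs : CoxeterSystem M W}
    {w : W} {u a b v : List B} (h : IsUniqueReducedWord cs w (u ++ a ++ v))
    (hab : cs.wordProd a = cs.wordProd b) (hlen : b.length ≤ a.length) : b = a := by
  obtain ⟨hw, hr, huniq⟩ := h
  have hprod : cs.wordProd (u ++ b ++ v) = w := by
    rw [← hw]
    simp only [cs.wordProd_append, hab]
  have hred : cs.IsReduced (u ++ b ++ v) := by
    have h1 := cs.length_wordProd_le (u ++ b ++ v)
    have h2 := hr.eq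
    rw [hw] at h2
    rw [CoxeterSystem.IsReduced]
    rw [hprod] at h1 ⊢
    simp only [List.length_append] at h1 h2 ⊢
    omega
  simpa using huniq _ hprod hred

/-- The word contains none of the factors which occur in no unique reduced word. -/
def AvoidsBraids (ω : List (Fin 3)) : Prop :=
  (∀ i, ¬ [i, i] <:+: ω) ∧ ¬ [0, 2] <:+: ω ∧ ¬ [2, 0] <:+: ω ∧ ¬ [0, 1, 0, 1] <:+: ω ∧
    ¬ [1, 0, 1, 0] <:+: ω ∧ ¬ [1, 2, 1, 2] <:+: ω

theorem IsUniqueReducedWord.avoidsBraids {M : CoxeterMatrix (Fin 3)} {cs : CoxeterSystem M W}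
    (h01 : M 0 1 = 4) (h12 : M 1 2 = 4) (h02 : M 0 2 = 2) {w : W} {ω : List (Fin 3)}
    (h : IsUniqueReducedWord cs w ω) : AvoidsBraids ω := by
  have h10 : M 1 0 = 4 := by rw [M.symmetric, h01]
  have h21 : M 2 1 = 4 := by rw [M.symmetric, h12]
  have h20 : M 2 0 = 2 := by rw [M.symmetric, h02]
  have e02 := cs.wordProd_braidWord_eq 0 2
  have e01 := cs.wordProd_braidWord_eq 0 1
  have e12 := cs.wordProd_braidWord_eq 1 2
  simp only [CoxeterSystem.braidWord, h01, h10, h12, h21, h02, h20,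
    CoxeterSystem.alternatingWord, List.concat_eq_append, List.nil_append, List.cons_append]
    at e02 e01 e12
  refine ⟨fun i hi => ?_, ?_, ?_, ?_, ?_, ?_⟩
  · obtain ⟨u, v, rfl⟩ := hi
    have := h.eq_of_wordProd_eq (b := []) (by simp [CoxeterSystem.wordProd]) (by simp)
    simp at this
  all_goals
    rintro ⟨u, v, rfl⟩
  · simpa using h.eq_of_wordProd_eq e02 le_rfl
  · simpa using h.eq_of_wordProd_eq e02.symm le_rfl
  · simpa using h.eq_of_wordProd_eq e01 le_rfl
  · simpa using h.eq_of_wordProd_eq e01.symm le_rfl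
  · simpa using h.eq_of_wordProd_eq e12 le_rfl

theorem AvoidsBraids.of_cons {i : Fin 3} {ω : List (Fin 3)} (h : AvoidsBraids (i :: ω)) :
    AvoidsBraids ω := by
  have key (a : List (Fin 3)) (ha : a <:+: ω) : a <:+: i :: ω := List.infix_cons ha
  obtain ⟨h1, h2, h3, h4, h5, h6⟩ := h
  exact ⟨fun i hi => h1 i (key _ hi), fun hi => h2 (key _ hi), fun hi => h3 (key _ hi),
    fun hi => h4 (key _ hi), fun hi => h5 (key _ hi), fun hi => h6 (key _ hi)⟩

theorem AvoidsBraids.eq_of_getLast? :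
    ∀ {ω : List (Fin 3)}, AvoidsBraids (0 :: ω) → (0 :: ω).getLast? = some 0 →
      0 :: ω = [0, 1, 0] ∨ ∃ n, 0 :: ω = yWord n
  | [], _, _ => .inr ⟨0, rfl⟩
  | [1], _, hl => by simp at hl
  | [1, 0], _, _ => .inl rfl
  | [1, 2], _, hl => by simp at hl
  | [1, 2, 1], _, hl => by simp at hl
  | 1 :: 2 :: 1 :: 0 :: ω, h, hl => by
    have hl' : (0 :: ω).getLast? = some 0 := by simpa using hl
    obtain h' | ⟨n, hn⟩ := eq_of_getLast? h.of_cons.of_cons.of_cons.of_cons hl'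
    · rw [h'] at h
      exact absurd ⟨[0, 1, 2], [], rfl⟩ h.2.2.2.2.1
    · exact .inr ⟨n + 1, by rw [hn, yWord_succ]⟩
  | 0 :: ω, h, _ => absurd ⟨[], ω, rfl⟩ (h.1 0)
  | 2 :: ω, h, _ => absurd ⟨[], ω, rfl⟩ h.2.1
  | 1 :: 1 :: ω, h, _ => absurd ⟨[0], ω, rfl⟩ (h.1 1)
  | 1 :: 0 :: 0 :: ω, h, _ => absurd ⟨[0, 1], ω, rfl⟩ (h.1 0)
  | 1 :: 0 :: 1 :: ω, h, _ => absurd ⟨[], ω, rfl⟩ h.2.2.2.1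
  | 1 :: 0 :: 2 :: ω, h, _ => absurd ⟨[0, 1], ω, rfl⟩ h.2.1
  | 1 :: 2 :: 0 :: ω, h, _ => absurd ⟨[0, 1], ω, rfl⟩ h.2.2.1
  | 1 :: 2 :: 2 :: ω, h, _ => absurd ⟨[0, 1], ω, rfl⟩ (h.1 2)
  | 1 :: 2 :: 1 :: 1 :: ω, h, _ => absurd ⟨[0, 1, 2], ω, rfl⟩ (h.1 1)
  | 1 :: 2 :: 1 :: 2 :: ω, h, _ => absurd ⟨[0], ω, rfl⟩ h.2.2.2.2.2

theorem IsUniqueReducedWord.mem_gammaSet {M : CoxeterMatrix B} {cs : CoxeterSystem M W}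
    {w : W} {ω : List B} {s : B} (h : IsUniqueReducedWord cs w ω) (hh : ω.head? = some s)
    (hl : ω.getLast? = some s) : w ∈ gammaSet cs s := by
  refine ⟨?_, ω, h, hh, hl⟩
  rintro rfl
  have := h.2.2 [] cs.wordProd_nil (by simp [CoxeterSystem.IsReduced])
  simp [← this] at hh

/-- For the Coxeter system with `S = {1,2,3}` (encoded as `Fin 3` via `1 ↦ 0`, `2 ↦ 1`,
`3 ↦ 2`), `m(1,2) = 4`, `m(2,3) = 4` and `m(1,3) = 2`: the set `Γ_1 ∩ Γ_1⁻¹` consists exactly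
of the generator `1`, the element with unique reduced word `121`, and for each `n ≥ 1` the
element `y_n` with unique reduced word `(1232)ⁿ 1`. -/
theorem gammaSet_description_B2_chain {M : CoxeterMatrix (Fin 3)} (cs : CoxeterSystem M W)
    (h01 : M 0 1 = 4) (h12 : M 1 2 = 4) (h02 : M 0 2 = 2) :
    IsUniqueReducedWord cs (cs.wordProd [0]) [0] ∧
    IsUniqueReducedWord cs (cs.wordProd [0, 1, 0]) [0, 1, 0] ∧
    (∀ n : ℕ, 1 ≤ n → IsUniqueReducedWord cs (cs.wordProd (yWord n)) (yWord n)) ∧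
    gammaSet cs 0 =
      {w : W | IsUniqueReducedWord cs w [0]} ∪
      {w : W | IsUniqueReducedWord cs w [0, 1, 0]} ∪
      {w : W | ∃ n : ℕ, 1 ≤ n ∧ IsUniqueReducedWord cs w (yWord n)} := by
  refine ⟨isRigid_zero.isUniqueReducedWord cs h01 h12 h02,
    isRigid_zero_one_zero.isUniqueReducedWord cs h01 h12 h02,
    fun n _ => (isRigid_yWord n).isUniqueReducedWord cs h01 h12 h02, ?_⟩
  ext w
  constructor
  · rintro ⟨-, _ | ⟨i, ω⟩, hω, hh, hl⟩
    · simp at hh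
    · obtain rfl : i = 0 := by simpa using hh
      obtain h | ⟨_ | n, hn⟩ := (hω.avoidsBraids h01 h12 h02).eq_of_getLast? hl
      · rw [h] at hω
        exact .inl (.inr hω)
      · rw [hn] at hω
        exact .inl (.inl hω)
      · rw [hn] at hω
        exact .inr ⟨n + 1, n.succ_pos, hω⟩
  · rintro ((h | h) | ⟨n, -, h⟩)
    · exact h.mem_gammaSet rfl rfl
    · exact h.mem_gammaSet rfl rfl
    · exact h.mem_gammaSet (head?_yWord n) (getLast?_yWord n)
end

section
/- Let (W,S) be the Coxeter system with S = {1,2,3}, m(1,2) = m(1,3) = 3, and m(2,3) = 4. Then every element of Γ_1 ∩ Γ_1^{-1} other than the generator 1 itself has unique reduced word expressible as an iterated glued product g_1 * g_2 * ⋯ * g_m with m ≥ 1, where each g_i belongs to the set {1231, 1321, 12321, 13231}. -/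
variable {B : Type*} {W : Type*} [Group W]

namespace IsUniqueReducedWord

variable {M : CoxeterMatrix B} {cs : CoxeterSystem M W} {w : W} {ω : List B}

/-- A unique reduced word contains no braid word as a factor. -/
theorem not_braidWord_isInfix (h : IsUniqueReducedWord cs w ω) {i j : B} (hij : i ≠ j)
    (hM : M i j ≠ 0) : ¬ CoxeterSystem.braidWord M i j <:+: ω := by
  rintro ⟨a, b, rfl⟩
  obtain ⟨hw, hred, huniq⟩ := h
  have hprod : cs.wordProd (a ++ CoxeterSystem.braidWord M j i ++ b) =
      cs.wordProd (a ++ CoxeterSystem.braidWord M i j ++ b) := by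
    simp only [cs.wordProd_append, cs.wordProd_braidWord_eq i j]
  have hlen : (CoxeterSystem.braidWord M j i).length =
      (CoxeterSystem.braidWord M i j).length := by
    simp [CoxeterSystem.braidWord, M.symmetric i j]
  have heq := huniq _ (hprod.trans hw) (by
    have := hred.eq
    rw [← hprod] at this
    refine this.trans ?_
    simp only [List.length_append, hlen])
  have hword : CoxeterSystem.braidWord M j i = CoxeterSystem.braidWord M i j := by
    simpa using heq
  obtain ⟨k, hk⟩ := Nat.exists_eq_succ_of_ne_zero hM
  have hlast := congrArg List.getLast? hword
  simp [CoxeterSystem.braidWord, M.symmetric j i, hk, CoxeterSystem.alternatingWord,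
    List.concat_eq_append] at hlast
  exact hij hlast

/-- A reduced word contains no repeated adjacent letter. -/
theorem _root_.CoxeterSystem.IsReduced.not_pair_isInfix (h : cs.IsReduced ω) (i : B) :
    ¬ [i, i] <:+: ω := by
  rintro ⟨a, b, rfl⟩
  have hprod : cs.wordProd (a ++ [i, i] ++ b) = cs.wordProd (a ++ b) := by
    simp [cs.wordProd_append, cs.wordProd_cons]
  have hle := cs.length_wordProd_le (a ++ b)
  rw [← hprod, h.eq] at hle
  simp at hle

end IsUniqueReducedWord

theorem glueFold_cons_cons {B : Type*} (g h : List B) (gs : List (List B)) (hh : h ≠ []) :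
    glueFold (g :: h :: gs) = g ++ (glueFold (h :: gs)).tail := by
  have key : ∀ (l : List (List B)) (x : List B),
      l.foldl glueWord x = x ++ l.flatMap List.tail := by
    intro l
    induction l with
    | nil => simp
    | cons y l ih => intro x; simp [ih, glueWord]
  simp [glueFold, key, List.tail_append_of_ne_nil hh]

/-- A word with first and last letter `0` avoiding the squares of letters, the factors of length
three alternating in `0` and another letter, and the factors of length four alternating in `1`
and `2`, is either `0` or an iterated glued product of four basic words. -/
theorem exists_glueFold_of_avoids (ω : List (Fin 3)) (hhead : ω.head? = some 0)
    (hlast : ω.getLast? = some 0) (hne : ω ≠ [0])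
    (hsq : ∀ i, ¬ [i, i] <:+: ω) (h3 : ∀ i, i ≠ 0 → ¬ [0, i, 0] <:+: ω)
    (h4 : ∀ i j, i ≠ j → i ≠ 0 → j ≠ 0 → ¬ [i, j, i, j] <:+: ω) :
    ∃ gs : List (List (Fin 3)), gs ≠ [] ∧
      (∀ g ∈ gs, g = [0, 1, 2, 0] ∨ g = [0, 2, 1, 0] ∨
        g = [0, 1, 2, 1, 0] ∨ g = [0, 2, 1, 2, 0]) ∧
      ω = glueFold gs := by
  have step : ∀ (g rest : List (Fin 3)),
      (g = [0, 1, 2] ∨ g = [0, 2, 1] ∨ g = [0, 1, 2, 1] ∨ g = [0, 2, 1, 2]) →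
      ω = g ++ 0 :: rest → ∃ gs : List (List (Fin 3)), gs ≠ [] ∧
        (∀ g ∈ gs, g = [0, 1, 2, 0] ∨ g = [0, 2, 1, 0] ∨
          g = [0, 1, 2, 1, 0] ∨ g = [0, 2, 1, 2, 0]) ∧
        ω = glueFold gs := by
    intro g rest hg hω
    have hg' : g ++ [0] = [0, 1, 2, 0] ∨ g ++ [0] = [0, 2, 1, 0] ∨
        g ++ [0] = [0, 1, 2, 1, 0] ∨ g ++ [0] = [0, 2, 1, 2, 0] := by
      rcases hg with rfl | rfl | rfl | rfl <;> simp
    have hlt : rest.length + 1 < ω.length := by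
      rcases hg with rfl | rfl | rfl | rfl <;> simp [hω]
    rcases eq_or_ne rest [] with rfl | hrest
    · exact ⟨[g ++ [0]], by simp, by simpa using hg', by simpa [glueFold] using hω⟩
    · have hinf : 0 :: rest <:+: ω := ⟨g, [], by simp [hω]⟩
      obtain ⟨gs, hgs, hmem, heq⟩ := exists_glueFold_of_avoids (0 :: rest) rfl
        (by rw [hω, List.getLast?_append] at hlast; simpa using hlast) (by simpa using hrest)
        (fun i hi => hsq i (hi.trans hinf)) (fun i h hi => h3 i h (hi.trans hinf))
        (fun i j h h' h'' hi => h4 i j h h' h'' (hi.trans hinf))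
      obtain ⟨h, t, rfl⟩ := List.exists_cons_of_ne_nil hgs
      refine ⟨(g ++ [0]) :: h :: t, by simp, List.forall_mem_cons.2 ⟨hg', hmem⟩, ?_⟩
      rw [glueFold_cons_cons _ _ _ (by rcases hmem h (by simp) with rfl | rfl | rfl | rfl <;> simp),
        ← heq, hω]
      simp
  have other : ∀ i j k : Fin 3, i ≠ 0 → j ≠ 0 → i ≠ j → k ≠ 0 → k ≠ j → k = i := by decide
  -- Write `ω = 0 i j …` with `i, j` the two nonzero letters.
  obtain ⟨l₁, rfl⟩ : ∃ l, ω = 0 :: l := by cases ω <;> simp_all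
  obtain ⟨i, l₂, rfl⟩ := List.exists_cons_of_ne_nil (l := l₁) (by simpa using hne)
  have hi : i ≠ 0 := by
    rintro rfl
    exact hsq 0 ⟨[], l₂, rfl⟩
  obtain ⟨j, l₃, rfl⟩ := List.exists_cons_of_ne_nil (l := l₂) (by
    rintro rfl
    exact hi (by simpa using hlast))
  have hj : j ≠ 0 := by
    rintro rfl
    exact h3 i hi ⟨[], l₃, rfl⟩
  have hij : i ≠ j := by
    rintro rfl
    exact hsq i ⟨[0], l₃, rfl⟩
  have hcases : i = 1 ∧ j = 2 ∨ i = 2 ∧ j = 1 := by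
    clear * - hi hj hij
    decide +revert
  obtain ⟨k, l₄, rfl⟩ := List.exists_cons_of_ne_nil (l := l₃) (by
    rintro rfl
    exact hj (by simpa using hlast))
  rcases eq_or_ne k 0 with rfl | hk
  · exact step [0, i, j] l₄ (by rcases hcases with ⟨rfl, rfl⟩ | ⟨rfl, rfl⟩ <;> simp) rfl
  obtain rfl : k = i := other i j k hi hj hij hk (by
    rintro rfl
    exact hsq k ⟨[0, i], l₄, rfl⟩)
  obtain ⟨m, l₅, rfl⟩ := List.exists_cons_of_ne_nil (l := l₄) (by
    rintro rfl
    exact hk (by simpa using hlast))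
  rcases eq_or_ne m 0 with rfl | hm
  · exact step [0, k, j, k] l₅ (by rcases hcases with ⟨rfl, rfl⟩ | ⟨rfl, rfl⟩ <;> simp) rfl
  obtain rfl : m = j := other j k m hj hk hij.symm hm (by
    rintro rfl
    exact hsq m ⟨[0, m, j], l₅, rfl⟩)
  exact absurd ⟨[0], l₅, rfl⟩ (h4 k m hij hk hj)
termination_by ω.length

/-- For the Coxeter system with `S = {1,2,3}` (encoded as `Fin 3` via `1 ↦ 0`, `2 ↦ 1`,
`3 ↦ 2`), `m(1,2) = m(1,3) = 3` and `m(2,3) = 4`: every element of `Γ_1 ∩ Γ_1⁻¹` other than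
the generator `1` itself has unique reduced word expressible as an iterated glued product
`g₁ * g₂ * ⋯ * gₘ` with `m ≥ 1`, where each `gᵢ` belongs to
`{1231, 1321, 12321, 13231}`. -/
theorem gammaSet_generated_by_four_words {M : CoxeterMatrix (Fin 3)} (cs : CoxeterSystem M W)
    (h01 : M 0 1 = 3) (h02 : M 0 2 = 3) (h12 : M 1 2 = 4) :
    ∀ w ∈ gammaSet cs 0, w ≠ cs.simple 0 →
      ∀ ω : List (Fin 3), IsUniqueReducedWord cs w ω →
        ∃ gs : List (List (Fin 3)), gs ≠ [] ∧
          (∀ g ∈ gs, g = [0, 1, 2, 0] ∨ g = [0, 2, 1, 0] ∨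
            g = [0, 1, 2, 1, 0] ∨ g = [0, 2, 1, 2, 0]) ∧
          ω = glueFold gs := by
  rintro w ⟨-, ω₀, h₀, hhead, hlast⟩ hw ω hω
  obtain rfl : ω = ω₀ := h₀.2.2 ω hω.1 hω.2.1
  refine exists_glueFold_of_avoids ω hhead hlast ?_ hω.2.1.not_pair_isInfix ?_ ?_
  · rintro rfl
    exact hw (by simpa using hω.1.symm)
  · intro i hi hinf
    have hM : M i 0 = 3 := by
      rw [M.symmetric]
      fin_cases i <;> simp_all
    refine hω.not_braidWord_isInfix hi (by simp [hM]) ?_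
    simpa [CoxeterSystem.braidWord, hM, CoxeterSystem.alternatingWord] using hinf
  · intro i j hij hi hj hinf
    have hM : M i j = 4 := by
      have h21 : M 2 1 = 4 := by rw [M.symmetric, h12]
      fin_cases i <;> fin_cases j <;> simp_all
    refine hω.not_braidWord_isInfix hij (by simp [hM]) ?_
    simpa [CoxeterSystem.braidWord, hM, CoxeterSystem.alternatingWord] using hinf
end
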